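/- arXiv:1902.02405 — 4 statements merged into one kernel-verified Lean document; each statement's English description precedes it below -/
import Mathlib

section
/- Let X and Y be real symmetric positive-definite n×n matrices and define c(A) = trace(XA)·trace(YA⁻¹) on the set of real symmetric positive-definite n×n matrices. A positive-definite matrix A is a global minimizer of c over the set of positive-definite matrices if and only if XA = γ A⁻¹ Y for some scalar γ > 0. -/
open Matrix

open scoped MatrixOrder in
theorem aux_sqrt {n : ℕ} {X : Matrix (Fin n) (Fin n) ℝ} (hX : X.PosDef) :
    ∃ S : Matrix (Fin n) (Fin n) ℝ, S.PosDef ∧ S * S = X := by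
  have h0 : 0 ≤ X := Matrix.nonneg_iff_posSemidef.mpr hX.posSemidef
  have hS : CFC.sqrt X * CFC.sqrt X = X := CFC.sqrt_mul_sqrt_self X h0
  refine ⟨CFC.sqrt X, ?_, hS⟩
  have hp : (CFC.sqrt X).PosSemidef := Matrix.nonneg_iff_posSemidef.mp (CFC.sqrt_nonneg X)
  rw [hp.posDef_iff_det_ne_zero]
  intro h
  have := hX.det_pos
  rw [← hS, det_mul, h] at this
  simp at this

theorem aux_trace {n : ℕ} {X W D : Matrix (Fin n) (Fin n) ℝ} (hX : X.PosDef) (hW : W.PosDef)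
    (hD : D.IsHermitian) :
    0 ≤ (X * (D * W * D)).trace ∧ ((X * (D * W * D)).trace = 0 → D = 0) := by
  obtain ⟨S, hS, rfl⟩ := aux_sqrt hX
  obtain ⟨T, hT, rfl⟩ := aux_sqrt hW
  have key : (S * S * (D * (T * T) * D)).trace = ((S * D * T) * (S * D * T)ᴴ).trace := by
    rw [conjTranspose_mul, conjTranspose_mul, hS.isHermitian.eq, hT.isHermitian.eq, hD.eq,
      mul_assoc S S, trace_mul_comm]
    simp only [mul_assoc]
  rw [key]
  refine ⟨(posSemidef_self_mul_conjTranspose _).trace_nonneg, fun h => ?_⟩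
  rw [trace_mul_conjTranspose_self_eq_zero_iff] at h
  rwa [hT.isUnit.mul_left_eq_zero, hS.isUnit.mul_right_eq_zero] at h

theorem aux_mean {n : ℕ} {X Y : Matrix (Fin n) (Fin n) ℝ} (hX : X.PosDef) (hY : Y.PosDef) :
    ∃ G : Matrix (Fin n) (Fin n) ℝ, G.PosDef ∧ G * X * G = Y := by
  obtain ⟨S, hS, rfl⟩ := aux_sqrt hX
  have hSu : IsUnit S.det := (isUnit_iff_isUnit_det _).mp hS.isUnit
  have h1 : (S * Y * S).PosDef := by
    have := (IsUnit.posDef_star_left_conjugate_iff (x := Y) hS.isUnit).mpr hY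
    rwa [star_eq_conjTranspose, hS.isHermitian.eq] at this
  obtain ⟨R, hR, hRR⟩ := aux_sqrt h1
  refine ⟨S⁻¹ * R * S⁻¹, ?_, ?_⟩
  · have := (IsUnit.posDef_star_left_conjugate_iff (x := R) hS.inv.isUnit).mpr hR
    rwa [star_eq_conjTranspose, hS.inv.isHermitian.eq] at this
  · calc S⁻¹ * R * S⁻¹ * (S * S) * (S⁻¹ * R * S⁻¹)
        = S⁻¹ * R * (S⁻¹ * S) * (S * S⁻¹) * R * S⁻¹ := by simp only [mul_assoc]
      _ = S⁻¹ * (R * R) * S⁻¹ := by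
        rw [nonsing_inv_mul _ hSu, mul_nonsing_inv _ hSu]; simp only [mul_assoc, mul_one, one_mul]
      _ = (S⁻¹ * S) * Y * (S * S⁻¹) := by rw [hRR]; simp only [mul_assoc]
      _ = Y := by rw [nonsing_inv_mul _ hSu, mul_nonsing_inv _ hSu, one_mul, mul_one]

theorem aux_expand {n : ℕ} {X A B : Matrix (Fin n) (Fin n) ℝ} (hB : B.PosDef) (t : ℝ) :
    (X * ((A - t • B) * B⁻¹ * (A - t • B))).trace =
      (A * X * A * B⁻¹).trace - 2 * t * (X * A).trace + t ^ 2 * (X * B).trace := by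
  have hBu : IsUnit B.det := (isUnit_iff_isUnit_det _).mp hB.isUnit
  have : (A - t • B) * B⁻¹ * (A - t • B) = A * B⁻¹ * A - (2 * t) • A + (t ^ 2) • B := by
    have e : (A - t • B) * B⁻¹ = A * B⁻¹ - t • 1 := by
      rw [sub_mul, smul_mul_assoc, mul_nonsing_inv _ hBu]
    rw [e, sub_mul, mul_sub, mul_smul_comm, mul_assoc A B⁻¹ B, nonsing_inv_mul _ hBu, mul_one,
      smul_mul_assoc, one_mul, smul_sub, smul_smul]
    module
  rw [this, mul_add, mul_sub, trace_add, trace_sub, mul_smul_comm, mul_smul_comm, trace_smul,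
    trace_smul, smul_eq_mul, smul_eq_mul]
  congr 2
  rw [← mul_assoc, trace_mul_comm]
  simp only [mul_assoc]

theorem aux_pos {n : ℕ} [Nonempty (Fin n)] {X A : Matrix (Fin n) (Fin n) ℝ} (hX : X.PosDef)
    (hA : A.PosDef) : 0 < (X * A).trace := by
  have h := aux_trace hX hA.inv hA.isHermitian
  have hAu : IsUnit A.det := (isUnit_iff_isUnit_det _).mp hA.isUnit
  rw [mul_nonsing_inv _ hAu, one_mul] at h
  refine lt_of_le_of_ne h.1 fun h0 => ?_
  have := hA.trace_pos
  rw [h.2 h0.symm] at this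
  simp at this

/-- A positive-definite matrix `A` is a global minimizer of
`c(A) = trace(X*A) * trace(Y*A⁻¹)` over the set of positive-definite matrices
if and only if `X*A = γ • (A⁻¹*Y)` for some scalar `γ > 0`. -/
theorem stmt3 {n : ℕ} (X Y A : Matrix (Fin n) (Fin n) ℝ)
    (hX : X.PosDef) (hY : Y.PosDef) (hA : A.PosDef) :
    (∀ B : Matrix (Fin n) (Fin n) ℝ, B.PosDef →
        (X * A).trace * (Y * A⁻¹).trace ≤ (X * B).trace * (Y * B⁻¹).trace) ↔
      ∃ γ : ℝ, 0 < γ ∧ X * A = γ • (A⁻¹ * Y) := by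
  rcases isEmpty_or_nonempty (Fin n) with he | hne
  · constructor
    · intro _
      exact ⟨1, one_pos, Subsingleton.elim _ _⟩
    · intro _ B _
      simp [Matrix.trace]
  have inv_r : ∀ {G : Matrix (Fin n) (Fin n) ℝ}, G.PosDef → G * G⁻¹ = 1 := fun h =>
    mul_nonsing_inv _ ((isUnit_iff_isUnit_det _).mp h.isUnit)
  have herm : ∀ {P Q : Matrix (Fin n) (Fin n) ℝ} (t : ℝ), P.PosDef → Q.PosDef →
      (P - t • Q).IsHermitian := by
    intro P Q t hP hQ
    rw [IsHermitian, conjTranspose_sub, conjTranspose_smul, hP.isHermitian.eq, hQ.isHermitian.eq]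
    simp
  have self : ∀ {G : Matrix (Fin n) (Fin n) ℝ}, G.PosDef →
      (G * X * G * G⁻¹).trace = (X * G).trace := by
    intro G hG
    rw [mul_assoc, inv_r hG, mul_one, trace_mul_comm]
  constructor
  · intro h
    obtain ⟨G, hG, rfl⟩ := aux_mean hX hY
    have hm := h G hG
    rw [self hG] at hm
    have pA := aux_pos hX hA
    have pG := aux_pos hX hG
    set t := (X * G).trace / (X * A).trace with ht
    have tpos : 0 < t := div_pos pG pA
    have hq := aux_trace hX hA.inv (herm t hG hA)
    rw [aux_expand hA t] at hq
    have htA : t * (X * A).trace = (X * G).trace := div_mul_cancel₀ _ pA.ne'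
    have hz : (G * X * G * A⁻¹).trace - 2 * t * (X * G).trace + t ^ 2 * (X * A).trace = 0 := by
      refine le_antisymm ?_ hq.1
      rw [← htA] at hm ⊢
      have : (G * X * G * A⁻¹).trace ≤ t ^ 2 * (X * A).trace := by
        refine le_of_mul_le_mul_left ?_ pA
        linarith
      linarith
    have hGA : G = t • A := sub_eq_zero.mp (hq.2 hz)
    refine ⟨(t ^ 2)⁻¹, by positivity, ?_⟩
    have hi : A⁻¹ * A = 1 := nonsing_inv_mul _ ((isUnit_iff_isUnit_det _).mp hA.isUnit)
    have : A⁻¹ * (G * X * G) = t ^ 2 • (X * A) := by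
      rw [hGA]
      simp only [smul_mul_assoc, mul_smul_comm, smul_smul]
      rw [← mul_assoc, ← mul_assoc, hi, one_mul, sq]
    rw [this, smul_smul, inv_mul_cancel₀ (by positivity), one_smul]
  · rintro ⟨γ, hγ, h⟩ B hB
    have hY' : A * X * A = γ • Y := by
      rw [mul_assoc, h, mul_smul_comm, ← mul_assoc, inv_r hA, one_mul]
    have tr : ∀ M : Matrix (Fin n) (Fin n) ℝ, (A * X * A * M).trace = γ * (Y * M).trace := by
      intro M
      rw [hY', smul_mul_assoc, trace_smul, smul_eq_mul]
    have h1 := tr A⁻¹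
    rw [self hA] at h1
    have pB := aux_pos hX hB
    set t := (X * A).trace / (X * B).trace with ht
    have htB : t * (X * B).trace = (X * A).trace := div_mul_cancel₀ _ pB.ne'
    have hq := (aux_trace hX hB.inv (herm t hA hB)).1
    rw [aux_expand hB t, tr] at hq
    refine le_of_mul_le_mul_left ?_ hγ
    have e : γ * ((X * A).trace * (Y * A⁻¹).trace) = (X * A).trace * (X * A).trace := by
      rw [mul_left_comm, ← h1]
    rw [e]
    rw [← htB] at hq ⊢
    have := mul_nonneg pB.le hq
    linarith
end

section
/- Let X and Y be real symmetric positive-definite n×n matrices and define c(A) = trace(XA)·trace(YA⁻¹). If a real symmetric positive-definite matrix A satisfies XA = γ A⁻¹ Y for some scalar γ > 0, then c(A) = (trace((X^{1/2} Y X^{1/2})^{1/2}))², where X^{1/2} denotes the unique positive-semidefinite square root of X and (X^{1/2} Y X^{1/2})^{1/2} the unique positive-semidefinite square root of the positive-definite matrix X^{1/2} Y X^{1/2}. -/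
open Matrix

open scoped MatrixOrder Matrix.Norms.L2Operator in
theorem psd_sq_unique {n : ℕ} (S T : Matrix (Fin n) (Fin n) ℝ)
    (hS : S.PosSemidef) (hT : T.PosSemidef) (h : T * T = S * S) : T = S := by
  have h1 := CFC.sqrt_unique h (Matrix.nonneg_iff_posSemidef.2 hT)
  have h2 := CFC.sqrt_unique (rfl : S * S = S * S) (Matrix.nonneg_iff_posSemidef.2 hS)
  exact h1.symm.trans h2

/-- If a symmetric positive-definite `A` satisfies `X * A = γ • (A⁻¹ * Y)` for some
`γ > 0`, then `c(A) = trace(X*A) * trace(Y*A⁻¹) = (trace((X^{1/2} Y X^{1/2})^{1/2}))²`.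
Here the unique positive-semidefinite square roots are encoded by quantifying over
any `R` (resp. `S`) that is positive semidefinite with `R * R = X`
(resp. `S * S = R * Y * R`). -/
theorem stmt7 {n : ℕ} (X Y A : Matrix (Fin n) (Fin n) ℝ)
    (hX : X.PosDef) (hY : Y.PosDef) (hA : A.PosDef)
    (γ : ℝ) (hγ : 0 < γ) (hcrit : X * A = γ • (A⁻¹ * Y))
    (R S : Matrix (Fin n) (Fin n) ℝ)
    (hR : R.PosSemidef) (hRX : R * R = X)
    (hS : S.PosSemidef) (hSM : S * S = R * Y * R) :
    (X * A).trace * (Y * A⁻¹).trace = S.trace ^ 2 := by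
  have hdet : IsUnit A.det := (Matrix.isUnit_iff_isUnit_det A).1 hA.isUnit
  have hAXA : A * (X * A) = γ • Y := by
    rw [hcrit, Matrix.mul_smul, Matrix.mul_nonsing_inv_cancel_left _ _ hdet]
  have hT : (R * A * R).PosSemidef := by
    have := hA.posSemidef.mul_mul_conjTranspose_same R
    rwa [hR.isHermitian.eq] at this
  have hg : √γ * √γ = γ := Real.mul_self_sqrt hγ.le
  have hTS : R * A * R = √γ • S := by
    apply psd_sq_unique _ _ (hS.smul (Real.sqrt_nonneg γ)) hT
    calc R * A * R * (R * A * R) = R * (A * ((R * R) * A)) * R := by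
          simp only [Matrix.mul_assoc]
      _ = γ • (S * S) := by
          rw [hRX, hAXA, hSM, Matrix.mul_smul, Matrix.smul_mul]
      _ = _ := by rw [Matrix.smul_mul, Matrix.mul_smul, smul_smul, hg]
  have t1 : (X * A).trace = √γ * S.trace := by
    rw [← hRX, Matrix.mul_assoc, Matrix.trace_mul_comm, hTS, Matrix.trace_smul, smul_eq_mul]
  have t2 : (X * A).trace = γ * (Y * A⁻¹).trace := by
    rw [hcrit, Matrix.trace_smul, smul_eq_mul, Matrix.trace_mul_comm]
  have : γ * ((X * A).trace * (Y * A⁻¹).trace) = γ * S.trace ^ 2 := by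
    calc _ = (X * A).trace * (γ * (Y * A⁻¹).trace) := by ring
      _ = (√γ * √γ) * S.trace ^ 2 := by rw [← t2, t1]; ring
      _ = _ := by rw [hg]
  exact mul_left_cancel₀ hγ.ne' this
end

section
/- Let n ≥ 2, let X and Y be real symmetric positive-definite n×n matrices, and define c(A) = trace(XA)·trace(YA⁻¹). Then for every real symmetric positive-definite n×n matrix A with λ_min(A) = 1, one has c(A) ≥ λ_min(X)·λ_min(Y)·(1 + ‖A‖)·(1 + ‖A‖⁻¹), where ‖A‖ denotes the spectral norm (largest eigenvalue) of A. Consequently, c is coercive on the set 𝒜₁ = { A positive definite : λ_min(A) = 1 }: c(A) → ∞ as ‖A‖ → ∞ within 𝒜₁. -/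
open Matrix

theorem aux_spec {n : ℕ} {H : Matrix (Fin n) (Fin n) ℝ} (hH : H.IsHermitian) :
    ∃ U : Matrix (Fin n) (Fin n) ℝ, Uᴴ * U = 1 ∧ U * Uᴴ = 1 ∧
      H = U * diagonal hH.eigenvalues * Uᴴ := by
  refine ⟨hH.eigenvectorUnitary, ?_, ?_, ?_⟩
  · exact Unitary.coe_star_mul_self hH.eigenvectorUnitary
  · exact Unitary.coe_mul_star_self hH.eigenvectorUnitary
  · have h := hH.spectral_theorem
    rw [Unitary.conjStarAlgAut_apply] at h
    exact h

theorem aux_trace_s11 {n : ℕ} {X B : Matrix (Fin n) (Fin n) ℝ} (hX : X.IsHermitian)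
    (hB : B.PosSemidef) :
    (⨅ i, hX.eigenvalues i) * B.trace ≤ (X * B).trace := by
  obtain ⟨U, h1, h2, h3⟩ := aux_spec hX
  have hC := hB.conjTranspose_mul_mul_same U
  have e1 : B.trace = (Uᴴ * B * U).trace := by
    rw [Matrix.trace_mul_cycle, h2, Matrix.one_mul]
  have e2 : (X * B).trace = (diagonal hX.eigenvalues * (Uᴴ * B * U)).trace := by
    conv_lhs => rw [h3]
    rw [Matrix.mul_assoc, Matrix.mul_assoc, Matrix.trace_mul_comm]
    simp only [Matrix.mul_assoc]
  rw [e1, e2, Matrix.trace, Matrix.trace, Finset.mul_sum]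
  apply Finset.sum_le_sum
  intro i _
  simp only [Matrix.diag_apply, Matrix.diagonal_mul]
  exact mul_le_mul_of_nonneg_right (ciInf_le (Set.finite_range _).bddBelow i) hC.diag_nonneg

theorem aux_inv_trace {n : ℕ} {A : Matrix (Fin n) (Fin n) ℝ} (hA : A.PosDef) :
    (A⁻¹).trace = ∑ i, (hA.1.eigenvalues i)⁻¹ := by
  obtain ⟨U, h1, h2, h3⟩ := aux_spec hA.1
  have hi : A⁻¹ = U * diagonal (fun i => (hA.1.eigenvalues i)⁻¹) * Uᴴ := by
    apply Matrix.inv_eq_right_inv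
    refine (congrArg (fun Z => Z * (U * diagonal (fun i => (hA.1.eigenvalues i)⁻¹) * Uᴴ)) h3).trans ?_
    beta_reduce
    have : U * diagonal hA.1.eigenvalues * Uᴴ * (U * diagonal (fun i => (hA.1.eigenvalues i)⁻¹) * Uᴴ)
      = U * (diagonal hA.1.eigenvalues * (Uᴴ * U) * diagonal (fun i => (hA.1.eigenvalues i)⁻¹)) * Uᴴ := by
      simp only [Matrix.mul_assoc]
    rw [this, h1, Matrix.mul_one, Matrix.diagonal_mul_diagonal]
    have : (fun i => hA.1.eigenvalues i * (hA.1.eigenvalues i)⁻¹) = fun _ => (1 : ℝ) := by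
      funext i
      exact mul_inv_cancel₀ (hA.eigenvalues_pos i).ne'
    rw [this, Matrix.diagonal_one, Matrix.mul_one, h2]
  rw [hi, Matrix.trace_mul_cycle, h1, Matrix.one_mul, Matrix.trace_diagonal]

theorem aux_pair {n : ℕ} (hn : 2 ≤ n) (f : Fin n → ℝ) :
    ∃ i j, i ≠ j ∧ f i = ⨅ k, f k ∧ f j = ⨆ k, f k := by
  have : Nontrivial (Fin n) := Fin.nontrivial_iff_two_le.mpr hn
  obtain ⟨i, hi⟩ := exists_eq_ciInf_of_finite (f := f)
  obtain ⟨j, hj⟩ := exists_eq_ciSup_of_finite (f := f)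
  by_cases h : i = j
  · obtain ⟨k, hk⟩ := exists_ne i
    refine ⟨i, k, hk.symm, hi, le_antisymm (le_ciSup (Set.finite_range _).bddAbove k) ?_⟩
    rw [← hj, ← h, hi]
    exact ciInf_le (Set.finite_range _).bddBelow k
  · exact ⟨i, j, h, hi, hj⟩

theorem aux_sum {n : ℕ} (g : Fin n → ℝ) (hg : ∀ i, 0 ≤ g i) {i j : Fin n} (h : i ≠ j) :
    g i + g j ≤ ∑ k, g k := by
  rw [← Finset.sum_pair h]
  exact Finset.sum_le_sum_of_subset_of_nonneg (Finset.subset_univ _) fun k _ _ => hg k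

theorem aux_min_pos {n : ℕ} (hn : 2 ≤ n) {X : Matrix (Fin n) (Fin n) ℝ} (hX : X.PosDef) :
    0 < ⨅ i, hX.1.eigenvalues i := by
  obtain ⟨i, _, _, hi, _⟩ := aux_pair hn hX.1.eigenvalues
  rw [← hi]
  exact hX.eigenvalues_pos i

theorem aux_main {n : ℕ} (hn : 2 ≤ n) (X Y : Matrix (Fin n) (Fin n) ℝ)
    (hX : X.PosDef) (hY : Y.PosDef) (A : Matrix (Fin n) (Fin n) ℝ) (hA : A.PosDef)
    (h1 : (⨅ i, hA.1.eigenvalues i) = 1) :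
    (⨅ i, hX.1.eigenvalues i) * (⨅ i, hY.1.eigenvalues i) *
            (1 + ⨆ i, hA.1.eigenvalues i) * (1 + (⨆ i, hA.1.eigenvalues i)⁻¹) ≤
          (X * A).trace * (Y * A⁻¹).trace := by
  have tX := aux_trace_s11 hX.1 hA.posSemidef
  have tY := aux_trace_s11 hY.1 hA.inv.posSemidef
  have pX := aux_min_pos hn hX
  have pY := aux_min_pos hn hY
  obtain ⟨i, j, hij, hi, hj⟩ := aux_pair hn hA.1.eigenvalues
  have sA : 1 + (⨆ i, hA.1.eigenvalues i) ≤ A.trace := by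
    have h := aux_sum hA.1.eigenvalues (fun k => (hA.eigenvalues_pos k).le) hij
    have ht : A.trace = ∑ k, hA.1.eigenvalues k := by
      simpa using hA.1.trace_eq_sum_eigenvalues
    rw [ht]
    rwa [hi, hj, h1] at h
  have sB : 1 + (⨆ i, hA.1.eigenvalues i)⁻¹ ≤ (A⁻¹).trace := by
    have h := aux_sum (fun k => (hA.1.eigenvalues k)⁻¹)
      (fun k => (inv_pos.mpr (hA.eigenvalues_pos k)).le) hij
    rw [aux_inv_trace hA]
    simpa only [hi, hj, h1, inv_one] using h
  have ps : 0 < ⨆ i, hA.1.eigenvalues i := hj ▸ hA.eigenvalues_pos j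
  generalize (⨆ i, hA.1.eigenvalues i) = s at *
  generalize (⨅ i, hX.1.eigenvalues i) = x at *
  generalize (⨅ i, hY.1.eigenvalues i) = y at *
  have ps' : 0 < s⁻¹ := inv_pos.mpr ps
  have a1 : x * (1 + s) ≤ (X * A).trace := (mul_le_mul_of_nonneg_left sA pX.le).trans tX
  have a2 : y * (1 + s⁻¹) ≤ (Y * A⁻¹).trace := (mul_le_mul_of_nonneg_left sB pY.le).trans tY
  calc x * y * (1 + s) * (1 + s⁻¹) = (x * (1 + s)) * (y * (1 + s⁻¹)) := by ring
    _ ≤ _ := mul_le_mul a1 a2 (by positivity) (le_trans (by positivity) a1)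

/-- For `n ≥ 2` and `X`, `Y` symmetric positive definite, every symmetric
positive-definite `A` with `λ_min(A) = 1` satisfies
`c(A) = trace(X*A) * trace(Y*A⁻¹) ≥ λ_min(X) λ_min(Y) (1 + ‖A‖)(1 + ‖A‖⁻¹)`,
where the spectral norm `‖A‖` of the positive-definite `A` is its largest
eigenvalue `⨆ i, hA.1.eigenvalues i`.  Consequently `c` is coercive on
`𝒜₁ = {A posdef : λ_min(A) = 1}`: for every bound `M` there is `R` such that
`c(A) ≥ M` whenever `A ∈ 𝒜₁` has `‖A‖ ≥ R`. -/
theorem stmt11 {n : ℕ} (hn : 2 ≤ n) (X Y : Matrix (Fin n) (Fin n) ℝ)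
    (hX : X.PosDef) (hY : Y.PosDef) :
    (∀ A : Matrix (Fin n) (Fin n) ℝ, ∀ hA : A.PosDef, (⨅ i, hA.1.eigenvalues i) = 1 →
        (⨅ i, hX.1.eigenvalues i) * (⨅ i, hY.1.eigenvalues i) *
            (1 + ⨆ i, hA.1.eigenvalues i) * (1 + (⨆ i, hA.1.eigenvalues i)⁻¹) ≤
          (X * A).trace * (Y * A⁻¹).trace) ∧
      (∀ M : ℝ, ∃ R : ℝ, ∀ A : Matrix (Fin n) (Fin n) ℝ, ∀ hA : A.PosDef,
        (⨅ i, hA.1.eigenvalues i) = 1 → R ≤ (⨆ i, hA.1.eigenvalues i) →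
          M ≤ (X * A).trace * (Y * A⁻¹).trace) := by
  refine ⟨fun A hA h1 => aux_main hn X Y hX hY A hA h1, fun M => ?_⟩
  have pX := aux_min_pos hn hX
  have pY := aux_min_pos hn hY
  refine ⟨max 1 (M / ((⨅ i, hX.1.eigenvalues i) * (⨅ i, hY.1.eigenvalues i))),
    fun A hA h1 hR => le_trans ?_ (aux_main hn X Y hX hY A hA h1)⟩
  generalize (⨆ i, hA.1.eigenvalues i) = s at *
  generalize (⨅ i, hX.1.eigenvalues i) = x at *
  generalize (⨅ i, hY.1.eigenvalues i) = y at *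
  have hs : 1 ≤ s := (le_max_left _ _).trans hR
  have hM : M / (x * y) ≤ s := (le_max_right _ _).trans hR
  have pxy : 0 < x * y := mul_pos pX pY
  rw [div_le_iff₀ pxy] at hM
  have ps' : 0 < s⁻¹ := by positivity
  have h2 : 0 ≤ x * y * (1 + s) := by positivity
  nlinarith [mul_nonneg h2 ps'.le]
end

section
/- Let X and Y be real symmetric positive-definite n×n matrices and define c(A) = trace(XA)·trace(YA⁻¹). Then c attains its global minimum over the set of all real symmetric positive-definite n×n matrices, and the minimum value equals (trace((X^{1/2} Y X^{1/2})^{1/2}))², where M^{1/2} denotes the unique positive-semidefinite square root of a positive-semidefinite matrix M. -/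
open Matrix

/-- `c(A) = trace(X*A) * trace(Y*A⁻¹)` attains its global minimum over the set of all
real symmetric positive-definite matrices, and the minimum value equals
`(trace((X^{1/2} Y X^{1/2})^{1/2}))²`.  The unique positive-semidefinite square roots
are encoded by quantifying over any `R` (resp. `S`) positive semidefinite with
`R * R = X` (resp. `S * S = R * Y * R`). -/
theorem stmt13 {n : ℕ} (X Y : Matrix (Fin n) (Fin n) ℝ)
    (hX : X.PosDef) (hY : Y.PosDef)
    (R S : Matrix (Fin n) (Fin n) ℝ)
    (hR : R.PosSemidef) (hRX : R * R = X)
    (hS : S.PosSemidef) (hSM : S * S = R * Y * R) :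
    ∃ A : Matrix (Fin n) (Fin n) ℝ, A.PosDef ∧
      (X * A).trace * (Y * A⁻¹).trace = S.trace ^ 2 ∧
      ∀ B : Matrix (Fin n) (Fin n) ℝ, B.PosDef →
        (X * A).trace * (Y * A⁻¹).trace ≤ (X * B).trace * (Y * B⁻¹).trace := by
  have hRu : IsUnit R := isUnit_of_mul_isUnit_left (hRX ▸ hX.isUnit)
  have hSu : IsUnit S := isUnit_of_mul_isUnit_left
    (hSM ▸ ((hRu.mul hY.isUnit).mul hRu))
  have hRd : IsUnit R.det := (Matrix.isUnit_iff_isUnit_det R).1 hRu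
  have hSd : IsUnit S.det := (Matrix.isUnit_iff_isUnit_det S).1 hSu
  have hSp : S.PosDef := hS.posDef_iff_isUnit.2 hSu
  have hRp : R.PosDef := hR.posDef_iff_isUnit.2 hRu
  have hRt : Rᴴ = R := hR.1
  have hRit : (R⁻¹)ᴴ = R⁻¹ := hRp.inv.1
  have hA : (R⁻¹ * S * R⁻¹).PosDef := by
    refine Matrix.PosSemidef.posDef_iff_isUnit ?_ |>.2
      ((hRp.inv.isUnit.mul hSu).mul hRp.inv.isUnit)
    have := hS.conjTranspose_mul_mul_same R⁻¹
    rwa [hRit] at this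
  have e1 : (X * (R⁻¹ * S * R⁻¹)).trace = S.trace := by
    rw [← hRX, Matrix.trace_mul_comm]
    rw [show R⁻¹ * S * R⁻¹ * (R * R) = R⁻¹ * S * ((R⁻¹ * R) * R) by simp only [mul_assoc]]
    rw [Matrix.nonsing_inv_mul _ hRd, one_mul, mul_assoc, Matrix.trace_mul_comm, mul_assoc,
      Matrix.mul_nonsing_inv _ hRd, mul_one]
  have e2 : (Y * (R⁻¹ * S * R⁻¹)⁻¹).trace = S.trace := by
    rw [Matrix.mul_inv_rev, Matrix.mul_inv_rev, Matrix.nonsing_inv_nonsing_inv _ hRd]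
    rw [show Y * (R * (S⁻¹ * R)) = (Y * R * S⁻¹) * R by simp only [mul_assoc],
      Matrix.trace_mul_comm,
      show R * (Y * R * S⁻¹) = (R * Y * R) * S⁻¹ by simp only [mul_assoc], ← hSM, mul_assoc,
      Matrix.mul_nonsing_inv _ hSd, mul_one]
  refine ⟨_, hA, by rw [e1, e2, sq], fun B hB => ?_⟩
  rw [e1, e2]
  have hBt : Bᴴ = B := hB.1
  have hBd : IsUnit B.det := (Matrix.isUnit_iff_isUnit_det B).1 hB.isUnit
  set P := R * B * R with hP
  have hPs : P.PosSemidef := by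
    have := hB.posSemidef.conjTranspose_mul_mul_same R
    rwa [hRt] at this
  have hPt : Pᴴ = P := hPs.1
  have hPd : IsUnit P.det :=
    (Matrix.isUnit_iff_isUnit_det P).1 ((hRu.mul hB.isUnit).mul hRu)
  have f1 : (X * B).trace = P.trace := by
    rw [← hRX, hP, mul_assoc, Matrix.trace_mul_comm]
  have f2 : (Y * B⁻¹).trace = (S * P⁻¹ * S).trace := by
    rw [Matrix.trace_mul_comm, Matrix.trace_mul_comm (S * P⁻¹) S, ← mul_assoc, hSM, hP,
      Matrix.mul_inv_rev, Matrix.mul_inv_rev]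
    rw [show R * Y * R * (R⁻¹ * (B⁻¹ * R⁻¹)) = R * Y * (R * R⁻¹) * (B⁻¹ * R⁻¹) by
      simp only [mul_assoc], Matrix.mul_nonsing_inv _ hRd, mul_one, Matrix.trace_mul_comm (R * Y),
      show B⁻¹ * R⁻¹ * (R * Y) = B⁻¹ * (R⁻¹ * R) * Y by simp only [mul_assoc],
      Matrix.nonsing_inv_mul _ hRd, mul_one]
  rw [f1, f2]
  have key : ∀ t : ℝ, 0 ≤ P.trace * (t * t) + (-2 * S.trace) * t + (S * P⁻¹ * S).trace := by
    intro t
    have h := (hPs.inv.conjTranspose_mul_mul_same (S - t • P)).trace_nonneg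
    have hSt : Sᴴ = S := hS.1
    have ht : (S - t • P)ᴴ = S - t • P := by
      rw [Matrix.conjTranspose_sub, Matrix.conjTranspose_smul, hSt, hPt]; simp
    rw [ht] at h
    have : (S - t • P) * P⁻¹ * (S - t • P) = S * P⁻¹ * S - t • S - t • S + (t * t) • P := by
      simp only [sub_mul, mul_sub, smul_mul_assoc, mul_smul_comm, smul_smul,
        Matrix.mul_nonsing_inv _ hPd, one_mul, mul_assoc, Matrix.nonsing_inv_mul _ hPd, mul_one]
      simp only [← mul_assoc, Matrix.mul_nonsing_inv _ hPd, one_mul, smul_sub, smul_smul]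
      abel
    rw [this] at h
    simp only [Matrix.trace_add, Matrix.trace_sub, Matrix.trace_smul, smul_eq_mul] at h
    linarith
  have := discrim_le_zero key
  unfold discrim at this
  nlinarith
end
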